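/- arXiv:2307.07777 — 7 statements merged into one kernel-verified Lean document; each statement's English description precedes it below -/
import Mathlib

section
/- Let T = (V, p0) be a directed forest and let p1 : V → V satisfy p1 ≼ p0. Then (V, p1) is a directed forest. -/
/-- A directed forest structure on `V`: `p` is the parent function, and any
periodic point of `p` is a fixed point. -/
def IsDirectedForest {V : Type*} (p : V → V) : Prop :=
  ∀ n : ℕ, 1 ≤ n → ∀ v : V, p^[n] v = v → p v = v

/-- `p1` is thinner than `p2` if for every vertex `v`, `p1 v ∈ {v, p2 v}`. -/
def Thinner {V : Type*} (p1 p2 : V → V) : Prop :=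
  ∀ v : V, p1 v = v ∨ p1 v = p2 v

theorem stmt_3 {V : Type*} [Nonempty V] (p0 p1 : V → V)
    (h0 : IsDirectedForest p0) (h : Thinner p1 p0) :
    IsDirectedForest p1 := by
  intro n hn v hv
  have key : ∀ k : ℕ, p1^[k] v = p0^[k] v ∨ p1 (p1^[k] v) = p1^[k] v := by
    intro k
    induction k with
    | zero => left; rfl
    | succ k ih =>
      rw [Function.iterate_succ_apply', Function.iterate_succ_apply']
      rcases ih with ih | ih
      · rcases h (p1^[k] v) with h1 | h1
        · right; rw [h1, h1]
        · left; rw [h1, ih]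
      · right; rw [ih, ih]
  rcases key n with hk | hk
  · have hp : p0 v = v := h0 n hn v (hk.symm.trans hv)
    rcases h v with h1 | h1
    · exact h1
    · exact h1.trans hp
  · rwa [hv] at hk
end

section
/- Let T1 = (V, p1) be a directed tree (a directed forest with exactly one tree, i.e. [u]_{T1} = V for every u ∈ V) and let T2 = (V, p2) be a directed forest with p1 ≼ p2. Then p1 = p2. In other words, directed trees are maximal with respect to the thickness relation. -/
/-- The tree (connected component) of `v` in the directed forest with
parent function `p`. -/
def treeOf {V : Type*} (p : V → V) (v : V) : Set V :=
  {u : V | ∃ m n : ℕ, p^[m] u = p^[n] v}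

theorem stmt_7 {V : Type*} [Nonempty V] (p1 p2 : V → V)
    (h1 : IsDirectedForest p1) (h2 : IsDirectedForest p2)
    (htree : ∀ u : V, treeOf p1 u = Set.univ) (h : Thinner p1 p2) :
    p1 = p2 := by
  have key : ∀ k : ℕ, ∀ w : V, ∃ j : ℕ, p1^[k] w = p2^[j] w := by
    intro k w
    induction k with
    | zero => exact ⟨0, rfl⟩
    | succ k ih =>
      obtain ⟨j, hj⟩ := ih
      rw [Function.iterate_succ_apply']
      rcases h (p1^[k] w) with h' | h'
      · exact ⟨j, by rw [h', hj]⟩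
      · exact ⟨j + 1, by rw [h', hj, Function.iterate_succ_apply']⟩
  funext v
  rcases h v with hv | hv
  · have hw : p2 v ∈ treeOf p1 v := by rw [htree v]; trivial
    obtain ⟨m, n, hmn⟩ := hw
    rw [Function.iterate_fixed hv n] at hmn
    obtain ⟨j, hj⟩ := key m (p2 v)
    have : p2 v = v := by
      apply h2 (j + 1) (by omega) v
      rw [Function.iterate_succ_apply, ← hj, hmn]
    rw [hv, this]
  · exact hv
end

section
/- Let T = (V, p) and T' = (V, p') be directed forests with p ≼ p'. Then for every k ≥ 1 the k-th powers satisfy T^k ≼ (T')^k, i.e. p^{[k]} ≼ (p')^{[k]}. -/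
open Classical in
/-- The parent function `p^{[k]}` of the `k`-th power of the directed forest
`(V, p)`: `p^{[k]} v = p^k v` if `p^{k-1} v` is not a root, and `v` otherwise. -/
noncomputable def kthPowerParent {V : Type*} (p : V → V) (k : ℕ) : V → V :=
  fun v => if p (p^[k - 1] v) = p^[k - 1] v then v else p^[k] v

theorem stmt_14 {V : Type*} [Nonempty V] (p p' : V → V)
    (h1 : IsDirectedForest p) (h2 : IsDirectedForest p') (h : Thinner p p') :
    ∀ k : ℕ, 1 ≤ k → Thinner (kthPowerParent p k) (kthPowerParent p' k) := by
  intro k hk v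
  obtain ⟨m, rfl⟩ : ∃ m, k = m + 1 := ⟨k - 1, by omega⟩
  have key : ∀ m : ℕ, p (p^[m] v) ≠ p^[m] v → p^[m] v = p'^[m] v := by
    intro m
    induction m with
    | zero => intro _; rfl
    | succ n ih =>
      intro hn
      simp only [Function.iterate_succ_apply'] at hn ⊢
      have hne : p (p^[n] v) ≠ p^[n] v := by
        intro he
        apply hn
        rw [he, he]
      rw [← ih hne]
      exact (h _).resolve_left hne
  by_cases hr : p (p^[m] v) = p^[m] v
  · left
    exact if_pos hr
  · right
    have hp := (h (p^[m] v)).resolve_left hr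
    have hr' : ¬ p' (p'^[m] v) = p'^[m] v := by
      rw [← key m hr, ← hp]
      exact hr
    refine (if_neg hr).trans (Eq.trans ?_ (if_neg hr').symm)
    rw [Function.iterate_succ_apply', Function.iterate_succ_apply', ← key m hr, hp]
end

section
/- For every directed forest T = (V, p) there exists a thickest element in the set of all leafless directed forests thinner than T: that is, there exists q : V → V such that (V, q) is a leafless directed forest with q ≼ p, and every q' : V → V for which (V, q') is a leafless directed forest with q' ≼ p satisfies q' ≼ q. -/
theorem forest_of_thinner {V : Type*} (p q : V → V) (hp : IsDirectedForest p)
    (hq : Thinner q p) : IsDirectedForest q := by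
  intro n hn v hv
  by_cases h : ∃ k, q (q^[k] v) = q^[k] v
  · obtain ⟨k, hk⟩ := h
    have h1 : q^[n * k] v = v := by
      rw [Function.iterate_mul]
      exact Function.iterate_fixed hv k
    have hle : k ≤ n * k := Nat.le_mul_of_pos_left k hn
    have h2 : q^[n * k] v = q^[k] v := by
      obtain ⟨m, hm⟩ := Nat.exists_eq_add_of_le' hle
      rw [hm, Function.iterate_add_apply]
      exact Function.iterate_fixed hk m
    have h3 : q^[k] v = v := h2.symm.trans h1
    rw [h3] at hk
    exact hk
  · push Not at h
    have h1 : ∀ k, q^[k] v = p^[k] v := by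
      intro k
      induction k with
      | zero => rfl
      | succ k ih =>
        rw [Function.iterate_succ_apply', Function.iterate_succ_apply', ← ih]
        exact (hq _).resolve_left (h k)
    have h2 : p v = v := hp n hn v (by rw [← h1]; exact hv)
    rcases hq v with h3 | h3
    · exact h3
    · exact h3.trans h2

theorem stmt_15 {V : Type*} [Nonempty V] (p : V → V) (hp : IsDirectedForest p) :
    ∃ q : V → V, IsDirectedForest q ∧ Function.Surjective q ∧ Thinner q p ∧
      ∀ q' : V → V, IsDirectedForest q' → Function.Surjective q' →
        Thinner q' p → Thinner q' q := by
  classical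
  let P : V → Prop := fun v => ∃ r : V → V, IsDirectedForest r ∧ Function.Surjective r ∧
    Thinner r p ∧ r v = p v
  let q : V → V := fun v => if P v then p v else v
  have hqP : ∀ v, P v → q v = p v := fun v h => if_pos h
  have hqN : ∀ v, ¬ P v → q v = v := fun v h => if_neg h
  have hqp : Thinner q p := by
    intro v
    by_cases h : P v
    · exact Or.inr (hqP v h)
    · exact Or.inl (hqN v h)
  refine ⟨q, forest_of_thinner p q hp hqp, ?_, hqp, ?_⟩
  · intro v
    by_cases hv : q v = v
    · exact ⟨v, hv⟩
    · have hP : P v := by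
        by_contra h
        exact hv (hqN v h)
      have hpv := hqP v hP
      obtain ⟨r, hr1, hr2, hr3, hr4⟩ := hP
      obtain ⟨u, hu⟩ := hr2 v
      rcases hr3 u with h | h
      · have huv : u = v := h.symm.trans hu
        subst huv
        exact absurd (hpv.trans (hr4.symm.trans hu)) hv
      · exact ⟨u, (hqP u ⟨r, hr1, hr2, hr3, h⟩).trans (h.symm.trans hu)⟩
  · intro r hr1 hr2 hr3 v
    rcases hr3 v with h | h
    · exact Or.inl h
    · exact Or.inr (h.trans (hqP v ⟨r, hr1, hr2, hr3, h⟩).symm)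
end

section
/- Let T = (V, p) be a directed forest and let q : V → V be a leafless support of T. Then for every v₀ ∈ V, v₀ is not a root of (V, q) (i.e. q(v₀) ≠ v₀) if and only if v₀ is not a root of T (i.e. p(v₀) ≠ v₀) and there exists a sequence (v_n)_{n≥1} in V such that, setting v_0 := v₀, one has p(v_{n+1}) = v_n for every n ≥ 0. -/
/-- `q` is a leafless support of the directed forest `(V, p)` if `(V, q)` is
the thickest leafless directed forest thinner than `(V, p)`. -/
def IsLeaflessSupport {V : Type*} (p q : V → V) : Prop :=
  IsDirectedForest q ∧ Function.Surjective q ∧ Thinner q p ∧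
    ∀ q' : V → V, IsDirectedForest q' → Function.Surjective q' →
      Thinner q' p → Thinner q' q

theorem stmt_16 {V : Type*} [Nonempty V] (p : V → V) (hp : IsDirectedForest p)
    (q : V → V) (hq : IsLeaflessSupport p q) :
    ∀ v₀ : V, q v₀ ≠ v₀ ↔
      p v₀ ≠ v₀ ∧ ∃ v : ℕ → V, v 0 = v₀ ∧ ∀ n : ℕ, p (v (n + 1)) = v n := by
  classical
  obtain ⟨-, hqs, hqp, hmax⟩ := hq
  intro v₀
  constructor
  · intro h0
    have step : ∀ x : {x : V // q x ≠ x}, ∃ y : {x : V // q x ≠ x}, p y.1 = x.1 := by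
      rintro ⟨x, hx⟩
      obtain ⟨w, hw⟩ := hqs x
      have hwx : q w ≠ w := by
        intro h
        have hxw : w = x := h.symm.trans hw
        subst hxw
        exact hx h
      refine ⟨⟨w, hwx⟩, ?_⟩
      rcases hqp w with h | h
      · exact absurd h hwx
      · exact h.symm.trans hw
    choose f hf using step
    refine ⟨?_, fun n => (f^[n] ⟨v₀, h0⟩).1, rfl, ?_⟩
    · rcases hqp v₀ with h | h
      · exact absurd h h0
      · rwa [← h]
    · intro n
      simp only [Function.iterate_succ_apply']
      exact hf _
  · rintro ⟨hp0, hA0⟩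
    let A : V → Prop := fun x => ∃ v : ℕ → V, v 0 = x ∧ ∀ n : ℕ, p (v (n + 1)) = v n
    have hAp : ∀ x, A x → A (p x) := by
      rintro x ⟨v, h0, hv⟩
      refine ⟨fun n => Nat.casesOn n (p x) v, rfl, ?_⟩
      intro n
      cases n with
      | zero => exact congrArg p h0
      | succ k => exact hv k
    let q' : V → V := fun x => if A x then p x else x
    have hq'A : ∀ x, A x → q' x = p x := fun x hx => if_pos hx
    have hq'N : ∀ x, ¬ A x → q' x = x := fun x hx => if_neg hx
    have hiter : ∀ (n : ℕ) (x : V), A x → q'^[n] x = p^[n] x := by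
      intro n
      induction n with
      | zero => intro x _; rfl
      | succ k ih =>
        intro x hx
        rw [Function.iterate_succ_apply, Function.iterate_succ_apply, hq'A x hx,
          ih _ (hAp x hx)]
    have key : Thinner q' q := by
      apply hmax
      · intro n hn x hx
        by_cases hxA : A x
        · rw [hq'A x hxA]
          rw [hiter n x hxA] at hx
          exact hp n hn x hx
        · exact hq'N x hxA
      · intro x
        by_cases hxA : A x
        · obtain ⟨v, h0, hv⟩ := hxA
          refine ⟨v 1, ?_⟩
          rw [hq'A (v 1) ⟨fun n => v (n + 1), rfl, fun n => hv (n + 1)⟩]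
          exact (hv 0).trans h0
        · exact ⟨x, hq'N x hxA⟩
      · intro x
        by_cases hxA : A x
        · exact Or.inr (hq'A x hxA)
        · exact Or.inl (hq'N x hxA)
    have e : q' v₀ = p v₀ := hq'A v₀ hA0
    rcases key v₀ with h | h
    · exact absurd (e.symm.trans h) hp0
    · rw [← h, e]
      exact hp0
end

section
/- Let T2 = (V, p2) be a forkless directed forest and let T1 = (V, p1) be a leafless directed forest with p1 ≼ p2. Then T1 is forkless. -/
/-- A directed forest `(V, p)` is forkless if every non-root vertex has
exactly one child. -/
def Forkless {V : Type*} (p : V → V) : Prop :=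
  ∀ v : V, p v ≠ v → ∃! u : V, p u = v ∧ u ≠ v

theorem stmt_17 {V : Type*} [Nonempty V] (p1 p2 : V → V)
    (h1 : IsDirectedForest p1) (h2 : IsDirectedForest p2)
    (hfork : Forkless p2) (hleafless : Function.Surjective p1)
    (h : Thinner p1 p2) :
    Forkless p1 := by
  intro v hv
  have hv2 : p2 v ≠ v := by
    rcases h v with e | e
    · exact absurd e hv
    · rwa [← e]
  have key : ∀ w, p1 w = v ∧ w ≠ v → p2 w = v ∧ w ≠ v := by
    rintro w ⟨hw, hne⟩
    refine ⟨?_, hne⟩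
    rcases h w with e | e
    · exact absurd (e.symm.trans hw) hne
    · exact e.symm.trans hw
  obtain ⟨u, hu⟩ := hleafless v
  have hu' : p1 u = v ∧ u ≠ v := ⟨hu, fun e => hv (by rw [← e, hu, e])⟩
  exact ⟨u, hu', fun w hw => (hfork v hv2).unique (key w hw) (key u hu')⟩
end

section
/- Let T = (V, p) be a leafless, locally countable directed forest. Then the following conditions are equivalent: (a) every bounded hyponormal weighted shift on T is power hyponormal; (b) for every bounded hyponormal weighted shift S on T, the operator S² is hyponormal; (c) T is a forkless forest. -/
noncomputable section

/-- The Hilbert space ℓ²(V) of square-summable complex functions on `V`. -/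
abbrev L2 (V : Type*) := lp (fun _ : V => ℂ) 2

/-- `S` is a (bounded) weighted shift on the directed forest `(V, p)`:
there is a system of weights `lam` (vanishing at roots) such that
`(S f)(v) = lam v * f (p v)` for all `f ∈ ℓ²(V)`. -/
def IsWeightedShift {V : Type*} (p : V → V) (S : L2 V →L[ℂ] L2 V) : Prop :=
  ∃ lam : V → ℂ, (∀ ω : V, p ω = ω → lam ω = 0) ∧
    ∀ f : L2 V, ∀ v : V, (S f : V → ℂ) v = lam v * (f : V → ℂ) (p v)

/-- A bounded operator on ℓ²(V) is hyponormal if `‖S* f‖ ≤ ‖S f‖` for all `f`. -/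
def Hyponormal {V : Type*} (S : L2 V →L[ℂ] L2 V) : Prop :=
  ∀ f : L2 V, ‖(ContinuousLinearMap.adjoint S) f‖ ≤ ‖S f‖

open Classical in
/-- The standard basis vector. -/
def E {V : Type*} (u : V) : L2 V := lp.single 2 u (1 : ℂ)

open Classical in
lemma E_apply {V : Type*} (u v : V) : (E u : V → ℂ) v = if v = u then 1 else 0 := by
  unfold E
  rw [lp.single_apply, Pi.single_apply]

lemma E_norm {V : Type*} (u : V) : ‖E u‖ = 1 := by
  classical
  unfold E
  rw [lp.norm_single (by norm_num)]; simp

lemma inner_E_left {V : Type*} (u : V) (f : L2 V) : inner ℂ (E u) f = f u := by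
  classical
  unfold E
  rw [lp.inner_single_left]; simp

lemma ext_E {V : Type*} {f g : L2 V} (h : ∀ u, f u = g u) : f = g :=
  lp.ext (funext h)

lemma norm_sq_sum_le {V : Type*} (f : L2 V) (s : Finset V) :
    ∑ i ∈ s, ‖f i‖ ^ 2 ≤ ‖f‖ ^ 2 := by
  have := lp.sum_rpow_le_norm_rpow (p := 2) (by norm_num) f s
  simpa using this

lemma norm_sq_sum_orth {ι H : Type*} [NormedAddCommGroup H] [InnerProductSpace ℂ H]
    (x : ι → H) (hx : ∀ i j, i ≠ j → inner ℂ (x i) (x j) = 0) (F : Finset ι) :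
    ‖∑ i ∈ F, x i‖ ^ 2 = ∑ i ∈ F, ‖x i‖ ^ 2 := by
  classical
  induction F using Finset.induction_on with
  | empty => simp
  | insert a s ha ih =>
    rw [Finset.sum_insert ha, Finset.sum_insert ha, ← ih]
    have : inner ℂ (x a) (∑ i ∈ s, x i) = 0 := by
      rw [inner_sum]
      apply Finset.sum_eq_zero
      intro i hi
      exact hx _ _ (fun h => ha (h ▸ hi))
    have := norm_add_sq_eq_norm_sq_add_norm_sq_of_inner_eq_zero _ _ this
    simpa [sq] using this

/-- `T` is the weighted composition operator with symbol `q` and weight `L`. -/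
def WC {V : Type*} (q : V → V) (L : V → ℂ) (T : L2 V →L[ℂ] L2 V) : Prop :=
  ∀ f : L2 V, ∀ v : V, (T f : V → ℂ) v = L v * (f : V → ℂ) (q v)

section crit
variable {V : Type*} {q : V → V} {L : V → ℂ} {T : L2 V →L[ℂ] L2 V}

open Classical in
lemma WC.apply_E (h : WC q L T) (u v : V) :
    (T (E u) : V → ℂ) v = if q v = u then L v else 0 := by
  rw [h, E_apply]; split_ifs <;> simp

lemma WC.adj_E (h : WC q L T) (u : V) :
    (ContinuousLinearMap.adjoint T) (E u) = (starRingEnd ℂ (L u)) • E (q u) := by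
  classical
  apply ext_E
  intro v
  rw [← inner_E_left, ContinuousLinearMap.adjoint_inner_right, ← inner_conj_symm, inner_E_left,
    h.apply_E]
  simp only [lp.coeFn_smul, Pi.smul_apply, E_apply, smul_eq_mul, eq_comm (a := v)]
  split_ifs <;> simp

lemma WC.orth (h : WC q L T) (u v : V) (huv : u ≠ v) :
    inner ℂ (T (E u)) (T (E v)) = 0 := by
  classical
  rw [lp.inner_eq_tsum]
  convert tsum_zero with w
  rw [h.apply_E, h.apply_E]
  split_ifs with h1 h2 <;> simp
  exact absurd (h1.symm.trans h2) huv

lemma WC.norm_sq_sum (h : WC q L T) (a : V → ℂ) (F : Finset V) :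
    ‖T (∑ u ∈ F, a u • E u)‖ ^ 2 = ∑ u ∈ F, ‖a u‖ ^ 2 * ‖T (E u)‖ ^ 2 := by
  rw [map_sum, norm_sq_sum_orth]
  · simp [norm_smul, mul_pow]
  · intro i j hij
    simp [inner_smul_left, inner_smul_right, h.orth i j hij]

lemma norm_sq_sum_E (a : V → ℂ) (F : Finset V) :
    ‖∑ u ∈ F, a u • E u‖ ^ 2 = ∑ u ∈ F, ‖a u‖ ^ 2 := by
  rw [norm_sq_sum_orth]
  · simp [norm_smul, E_norm]
  · intro i j hij
    simp [inner_smul_left, inner_smul_right, inner_E_left, E_apply, hij]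

lemma WC.le_norm (h : WC q L T) (u : V) (F : Finset V) (hF : ∀ v ∈ F, q v = u) :
    ∑ v ∈ F, ‖L v‖ ^ 2 ≤ ‖T (E u)‖ ^ 2 := by
  refine le_trans (le_of_eq ?_) (norm_sq_sum_le (T (E u)) F)
  apply Finset.sum_congr rfl
  intro v hv
  rw [h.apply_E, if_pos (hF v hv)]

/-- The criterion. -/
def Crit {V : Type*} (q : V → V) (L : V → ℂ) (T : L2 V →L[ℂ] L2 V) : Prop :=
  (∀ u, T (E u) = 0 → L u = 0) ∧ ∀ v, ∀ F : Finset V, (∀ u ∈ F, q u = v) →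
    ∑ u ∈ F, ‖L u‖ ^ 2 / ‖T (E u)‖ ^ 2 ≤ 1

lemma WC.crit_of_hyp (h : WC q L T) (hT : Hyponormal T) : Crit q L T := by
  classical
  constructor
  · intro u hu
    have := hT (E u)
    rw [h.adj_E, hu, norm_smul, E_norm] at this
    simpa using this
  · intro v F hF
    set s := ∑ u ∈ F, ‖L u‖ ^ 2 / ‖T (E u)‖ ^ 2 with hs
    have hs0 : 0 ≤ s := Finset.sum_nonneg fun i _ => by positivity
    let a : V → ℂ := fun u => L u / (‖T (E u)‖ ^ 2 : ℝ)
    have h1 := hT (∑ u ∈ F, a u • E u)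
    have h2 : (ContinuousLinearMap.adjoint T) (∑ u ∈ F, a u • E u) = (s : ℂ) • E v := by
      rw [map_sum, hs, Complex.ofReal_sum, Finset.sum_smul]
      apply Finset.sum_congr rfl
      intro u hu
      rw [map_smul, h.adj_E, hF u hu, smul_smul]
      congr 1
      simp only [a]
      rw [div_mul_eq_mul_div, Complex.mul_conj, Complex.normSq_eq_norm_sq]
      push_cast; rfl
    have h3 : ‖T (∑ u ∈ F, a u • E u)‖ ^ 2 = s := by
      rw [h.norm_sq_sum, hs]
      apply Finset.sum_congr rfl
      intro u hu
      simp only [a, norm_div, Complex.norm_real, norm_pow, norm_norm]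
      by_cases h0 : ‖T (E u)‖ = 0
      · simp [h0]
      · field_simp
    rw [h2, norm_smul, E_norm] at h1
    simp only [Complex.norm_real, mul_one, Real.norm_eq_abs, abs_of_nonneg hs0] at h1
    have h4 : s ^ 2 ≤ s := by
      exact (pow_le_pow_left₀ hs0 h1 2).trans h3.le
    nlinarith

lemma WC.hyp_of_crit (h : WC q L T) (hc : Crit q L T) : Hyponormal T := by
  classical
  intro f
  have hsum : HasSum (fun i => (f i) • E i) f := by
    have := lp.hasSum_single (p := 2) (by norm_num) f
    convert this using 2 with i
    unfold E
    rw [← lp.single_smul]; simp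
  have key : ∀ F : Finset V, ‖(ContinuousLinearMap.adjoint T) (∑ u ∈ F, f u • E u)‖ ≤
      ‖T (∑ u ∈ F, f u • E u)‖ := by
    intro F
    apply le_of_sq_le_sq _ (norm_nonneg _)
    rw [h.norm_sq_sum]
    have e1 : (ContinuousLinearMap.adjoint T) (∑ u ∈ F, f u • E u) =
        ∑ v ∈ F.image q, (∑ u ∈ F with q u = v, f u * (starRingEnd ℂ (L u))) • E v := by
      rw [map_sum, ← Finset.sum_fiberwise_of_maps_to (fun i hi => Finset.mem_image_of_mem q hi)]
      apply Finset.sum_congr rfl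
      intro v hv
      rw [Finset.sum_smul]
      apply Finset.sum_congr rfl
      intro u hu
      rw [map_smul, h.adj_E, smul_smul, (Finset.mem_filter.1 hu).2]
    rw [e1, norm_sq_sum_E,
      ← Finset.sum_fiberwise_of_maps_to (s := F) (fun i hi => Finset.mem_image_of_mem q hi)]
    apply Finset.sum_le_sum
    intro v hv
    have h1 := hc.2 v (F.filter (fun u => q u = v)) (fun u hu => (Finset.mem_filter.1 hu).2)
    have h2 := Finset.sum_sq_le_sum_mul_sum_of_sq_le_mul (F.filter (fun u => q u = v))
      (r := fun u => ‖f u‖ * ‖L u‖) (f := fun u => ‖L u‖ ^ 2 / ‖T (E u)‖ ^ 2)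
      (g := fun u => ‖f u‖ ^ 2 * ‖T (E u)‖ ^ 2)
      (fun i _ => by positivity) (fun i _ => by positivity) (fun i _ => le_of_eq <| by
        by_cases h0 : T (E i) = 0
        · simp [h0, hc.1 i h0]
        · have : ‖T (E i)‖ ≠ 0 := by simpa using h0
          field_simp)
    have h3 : ‖∑ u ∈ F with q u = v, f u * (starRingEnd ℂ (L u))‖ ≤
        ∑ u ∈ F with q u = v, ‖f u‖ * ‖L u‖ := by
      refine (norm_sum_le _ _).trans (le_of_eq ?_)
      simp
    refine (pow_le_pow_left₀ (norm_nonneg _) h3 2).trans (h2.trans ?_)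
    have h4 : 0 ≤ ∑ u ∈ F with q u = v, ‖f u‖ ^ 2 * ‖T (E u)‖ ^ 2 :=
      Finset.sum_nonneg fun i _ => by positivity
    exact mul_le_of_le_one_left h4 h1
  have t1 := (((ContinuousLinearMap.adjoint T).continuous.norm).tendsto f).comp hsum
  have t2 := ((T.continuous.norm).tendsto f).comp hsum
  exact le_of_tendsto_of_tendsto t1 t2 (Filter.Eventually.of_forall key)

lemma WC.exists (M : ℝ) (hM : 0 ≤ M) (q : V → V) (L : V → ℂ)
    (hL : ∀ v, ∀ F : Finset V, (∀ u ∈ F, q u = v) → ∑ u ∈ F, ‖L u‖ ^ 2 ≤ M ^ 2) :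
    ∃ T : L2 V →L[ℂ] L2 V, WC q L T := by
  classical
  have key : ∀ f : L2 V, ∀ F : Finset V, ∑ v ∈ F, ‖L v * f (q v)‖ ^ 2 ≤ (M * ‖f‖) ^ 2 := by
    intro f F
    rw [← Finset.sum_fiberwise_of_maps_to (s := F) (fun i hi => Finset.mem_image_of_mem q hi)]
    rw [mul_pow]
    refine le_trans ?_ (mul_le_mul_of_nonneg_left (norm_sq_sum_le f (F.image q)) (by positivity))
    rw [Finset.mul_sum]
    apply Finset.sum_le_sum
    intro w hw
    have h1 := hL w (F.filter (fun u => q u = w)) (fun u hu => (Finset.mem_filter.1 hu).2)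
    refine le_trans (le_of_eq ?_) (mul_le_mul_of_nonneg_right h1 (by positivity))
    rw [Finset.sum_mul]
    apply Finset.sum_congr rfl
    intro u hu
    rw [(Finset.mem_filter.1 hu).2, norm_mul, mul_pow]
  have hmem : ∀ f : L2 V, Memℓp (fun v => L v * f (q v)) 2 := fun f =>
    memℓp_gen' (C := (M * ‖f‖) ^ 2) (fun s => by simpa using key f s)
  let T0 : L2 V →ₗ[ℂ] L2 V :=
    { toFun := fun f => ⟨fun v => L v * f (q v), hmem f⟩
      map_add' := fun f g => by
        apply ext_E; intro v
        simp only [lp.coeFn_add, Pi.add_apply]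
        exact mul_add _ _ _
      map_smul' := fun c f => by
        apply ext_E; intro v
        simp only [lp.coeFn_smul, Pi.smul_apply, smul_eq_mul, RingHom.id_apply]
        exact mul_left_comm _ _ _ }
  refine ⟨T0.mkContinuous M (fun f => ?_), fun f v => rfl⟩
  apply lp.norm_le_of_forall_sum_le (by norm_num) (by positivity)
  intro s
  have := key f s
  simp only [ENNReal.toReal_ofNat, Real.rpow_ofNat]
  exact this

end crit

section powers
variable {V : Type*} {p : V → V} {lam : V → ℂ} {S : L2 V →L[ℂ] L2 V}

/-- Weights of powers. -/
def Lam {V : Type*} (p : V → V) (lam : V → ℂ) : ℕ → V → ℂ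
  | 0, _ => 1
  | k + 1, v => lam v * Lam p lam k (p v)

lemma WC.pow (h : WC p lam S) (n : ℕ) : WC (p^[n]) (Lam p lam n) (S ^ n) := by
  induction n with
  | zero => intro f v; simp [Lam]
  | succ k ih =>
    intro f v
    rw [pow_succ', ContinuousLinearMap.mul_apply, h, ih, Lam, mul_assoc]
    rfl

lemma WC.apply_E_single (h : WC p lam S) {u c : V} (hc : p c = u)
    (hu : ∀ x, p x = u → lam x ≠ 0 → x = c) : S (E u) = lam c • E c := by
  classical
  apply ext_E
  intro v
  rw [h.apply_E]
  simp only [lp.coeFn_smul, Pi.smul_apply, E_apply, smul_eq_mul]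
  by_cases hv : v = c
  · subst hv; simp [hc]
  · rw [if_neg hv, mul_zero]
    split_ifs with h1
    · by_contra h2
      exact hv (hu v h1 h2)
    · rfl

lemma Lam_eq_zero (k : ℕ) (u : V) (h : lam (p^[k] u) = 0) : Lam p lam (k + 1) u = 0 := by
  induction k generalizing u with
  | zero => simp only [Function.iterate_zero, id] at h; simp [Lam, h]
  | succ k ih => rw [Lam, ih (p u) h, mul_zero]

lemma Lam_chain {c : V → V} (hc : ∀ v, p (c v) = v) (k : ℕ) (x : V) :
    Lam p lam (k + 1) (c^[k] x) = ∏ i ∈ Finset.range (k + 1), lam (c^[i] x) := by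
  induction k with
  | zero => simp [Lam]
  | succ k ih =>
    rw [Finset.prod_range_succ, ← ih, Lam, Function.iterate_succ_apply', hc, mul_comm]

lemma nonroot_iter {c : V → V} (hc : ∀ v, p (c v) = v) (x : V) (hx : p x ≠ x) (k : ℕ) :
    p (c^[k] x) ≠ c^[k] x := by
  induction k with
  | zero => simpa
  | succ k ih =>
    rw [Function.iterate_succ_apply', hc]
    intro h
    apply ih
    conv_lhs => rw [h]
    rw [hc]

lemma chain_of_iter {c : V → V} (hc : ∀ v, p (c v) = v)
    (hu : ∀ x, p x ≠ x → ∀ y, p y = x → y = c x) (x : V) (hx : p x ≠ x) (k : ℕ) (u : V)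
    (h : p^[k] u = x) : u = c^[k] x := by
  induction k generalizing u with
  | zero => simpa using h
  | succ k ih =>
    have h1 := ih (p u) h
    rw [Function.iterate_succ_apply']
    exact hu _ (nonroot_iter hc x hx k) u h1

lemma WC.pow_E (h : WC p lam S) {c : V → V} (hc : ∀ v, p (c v) = v)
    (hu : ∀ x, p x ≠ x → ∀ y, p y = x → y = c x) (x : V) (hx : p x ≠ x) (n : ℕ) :
    (S ^ n) (E x) = (∏ i ∈ Finset.range n, lam (c^[i + 1] x)) • E (c^[n] x) := by
  induction n with
  | zero => simp
  | succ k ih =>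
    rw [pow_succ', ContinuousLinearMap.mul_apply, ih, map_smul,
      h.apply_E_single (hc _) (fun y hy _ => hu _ (nonroot_iter hc x hx k) y hy), smul_smul,
      Finset.prod_range_succ, Function.iterate_succ_apply']

lemma forkless_pow (hsurj : Function.Surjective p) (hf : Forkless p)
    (hroot : ∀ ω : V, p ω = ω → lam ω = 0) (h : WC p lam S) (hS : Hyponormal S) (n : ℕ)
    (hn : 1 ≤ n) : Hyponormal (S ^ n) := by
  classical
  obtain ⟨k, rfl⟩ : ∃ k, n = k + 1 := ⟨n - 1, by omega⟩
  have hcr := h.crit_of_hyp hS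
  obtain ⟨c, hc⟩ : ∃ c : V → V, ∀ v, p (c v) = v :=
    ⟨Function.surjInv hsurj, Function.surjInv_eq hsurj⟩
  have hu : ∀ x, p x ≠ x → ∀ y, p y = x → y = c x := by
    intro x hx y hy
    have h1 : ∀ y, p y = x → y ≠ x := fun y hy hyx => hx (by rw [hyx] at hy; exact hy)
    exact (hf x hx).unique ⟨hy, h1 _ hy⟩ ⟨hc x, h1 _ (hc x)⟩
  have hSE : ∀ x, p x ≠ x → ‖S (E x)‖ = ‖lam (c x)‖ := by
    intro x hx
    have := h.pow_E hc hu x hx 1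
    rw [pow_one] at this
    rw [this, norm_smul, E_norm]; simp
  have mono : ∀ x, p x ≠ x → ‖lam x‖ ≤ ‖lam (c x)‖ := by
    intro x hx
    rw [← hSE x hx]
    have h1 := hcr.2 (p x) {x} (by simp)
    by_cases h0 : S (E x) = 0
    · rw [hcr.1 x h0]; simp
    · have : 0 < ‖S (E x)‖ := by simpa using h0
      rw [Finset.sum_singleton, div_le_one (by positivity)] at h1
      exact le_of_sq_le_sq h1 (by positivity)
  -- data for a vertex with nonzero weight
  have key : ∀ u, Lam p lam (k + 1) u ≠ 0 → p (p^[k] u) ≠ p^[k] u ∧ u = c^[k] (p^[k] u) ∧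
      0 < ‖(S ^ (k + 1)) (E u)‖ ∧ ‖Lam p lam (k + 1) u‖ ^ 2 / ‖(S ^ (k + 1)) (E u)‖ ^ 2 ≤
        ‖lam (p^[k] u)‖ ^ 2 / ‖S (E (p^[k] u))‖ ^ 2 := by
    intro u hL
    have hl : lam (p^[k] u) ≠ 0 := fun h0 => hL (Lam_eq_zero k u h0)
    have hx : p (p^[k] u) ≠ p^[k] u := fun h0 => hl (hroot _ h0)
    have hux := chain_of_iter hc hu _ hx k u rfl
    generalize p^[k] u = x at *
    subst hux
    set m : ℕ → ℝ := fun i => ‖lam (c^[i] x)‖ with hm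
    have hmm : Monotone m := monotone_nat_of_le_succ (fun i => by
      simp only [hm, Function.iterate_succ_apply']
      exact mono _ (nonroot_iter hc x hx i))
    have hm0 : 0 < m 0 := by simpa [hm] using hl
    have hmp : ∀ i, 0 < m i := fun i => hm0.trans_le (hmm (Nat.zero_le i))
    have e1 : ‖Lam p lam (k + 1) (c^[k] x)‖ = ∏ i ∈ Finset.range (k + 1), m i := by
      rw [Lam_chain hc, norm_prod]
    have e2 : ‖(S ^ (k + 1)) (E (c^[k] x))‖ = ∏ i ∈ Finset.range (k + 1), m (i + 1 + k) := by
      rw [h.pow_E hc hu _ (nonroot_iter hc x hx k), norm_smul, E_norm, norm_prod, mul_one]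
      simp only [hm, Function.iterate_add_apply]
    have e3 : ‖S (E x)‖ = m 1 := by rw [hSE x hx]; rfl
    have e4 : ‖lam x‖ = m 0 := rfl
    have hpos : 0 < ∏ i ∈ Finset.range (k + 1), m (i + 1 + k) :=
      Finset.prod_pos fun i _ => hmp _
    refine ⟨hx, rfl, by rw [e2]; exact hpos, ?_⟩
    rw [e1, e2, e3, e4, ← div_pow, ← div_pow]
    have hnn : 0 ≤ ∏ i ∈ Finset.range (k + 1), m i := Finset.prod_nonneg fun i _ => (hmp i).le
    apply pow_le_pow_left₀ (div_nonneg hnn hpos.le)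
    rw [div_le_div_iff₀ hpos (hmp 1), Finset.prod_range_succ', Finset.prod_range_succ]
    have a1 : ∏ i ∈ Finset.range k, m (i + 1) ≤ ∏ i ∈ Finset.range k, m (i + 1 + k) :=
      Finset.prod_le_prod (fun i _ => (hmp _).le) (fun i _ => hmm (by omega))
    have a2 : m 1 ≤ m (k + 1 + k) := hmm (by omega)
    have a3 := mul_le_mul a1 a2 (hmp 1).le (Finset.prod_nonneg fun i _ => (hmp _).le)
    calc _ = m 0 * ((∏ i ∈ Finset.range k, m (i + 1)) * m 1) := by ring
      _ ≤ _ := mul_le_mul_of_nonneg_left a3 hm0.le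
  apply (h.pow (k + 1)).hyp_of_crit
  constructor
  · intro u h0
    by_contra hL
    have := (key u hL).2.2.1
    rw [h0] at this
    simp at this
  · intro v F hF
    rw [← Finset.sum_filter_of_ne (p := fun u => Lam p lam (k + 1) u ≠ 0)
      (fun u _ hne h0 => hne (by rw [h0]; simp))]
    have hinj : Set.InjOn (p^[k])
        (↑(F.filter (fun u => Lam p lam (k + 1) u ≠ 0)) : Set V) := by
      intro a ha b hb hab
      rw [(key a (Finset.mem_filter.1 ha).2).2.1, (key b (Finset.mem_filter.1 hb).2).2.1, hab]
    have h1 := hcr.2 v ((F.filter (fun u => Lam p lam (k + 1) u ≠ 0)).image (p^[k])) (by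
      intro x hx
      obtain ⟨u, hu', rfl⟩ := Finset.mem_image.1 hx
      rw [← hF u (Finset.mem_filter.1 hu').1, Function.iterate_succ_apply'])
    rw [Finset.sum_image hinj] at h1
    refine le_trans (Finset.sum_le_sum ?_) h1
    intro u hu'
    exact (key u (Finset.mem_filter.1 hu').2).2.2.2

end powers

lemma sum_le_of_support {V : Type*} (g : V → ℝ) (hg : ∀ v, 0 ≤ g v) (F G : Finset V)
    (h : ∀ u ∈ F, g u ≠ 0 → u ∈ G) : ∑ u ∈ F, g u ≤ ∑ u ∈ G, g u := by
  classical
  rw [← Finset.sum_filter_of_ne (p := fun u => g u ≠ 0) (fun u _ hne => hne)]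
  apply Finset.sum_le_sum_of_subset_of_nonneg
  · intro u hu
    exact h u (Finset.mem_filter.1 hu).1 (Finset.mem_filter.1 hu).2
  · intro i _ _; exact hg i

lemma exists_weights {V : Type*} (p : V → V) (hp : IsDirectedForest p) (c : V → V)
    (hc : ∀ v, p (c v) = v) (v0 a b : V) (hv0 : p v0 ≠ v0) (ha : p a = v0) (hb : p b = v0)
    (hab : a ≠ b) :
    ∃ (lam : V → ℂ) (A B : V → Prop), lam v0 = 8 / 5 ∧ lam a = 3 / 5 ∧ lam b = 8 / 5 ∧
      (∀ v, A v → lam v = 1) ∧ (∀ v, B v → lam v = 2) ∧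
      (∀ v, lam v ≠ 0 → v = v0 ∨ v = a ∨ v = b ∨ A v ∨ B v) ∧
      A (c a) ∧ B (c b) ∧ (∀ v, A v → A (c v)) ∧ (∀ v, B v → B (c v)) ∧
      (∀ v, A v ∨ B v → v = c (p v)) ∧
      (∀ v, A v ∨ B v → p v ≠ v0 ∧ p v ≠ p v0) ∧
      a ≠ v0 ∧ a ≠ p v0 ∧ b ≠ v0 ∧ b ≠ p v0 ∧ (∀ v, A v ∨ B v → p v ≠ v) ∧
      (∀ v, A v ∨ B v → v ≠ v0 ∧ v ≠ p v0) := by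
  classical
  have per : ∀ n, p^[n + 1] v0 ≠ v0 := fun n h => hv0 (hp (n + 1) (by omega) v0 h)
  have hDv : ∀ n x, p^[n + 1] x = v0 → x ≠ v0 ∧ x ≠ p v0 := by
    intro n x hx
    refine ⟨fun h => per n (h ▸ hx), fun h => per (n + 1) ?_⟩
    rw [Function.iterate_succ_apply, ← h, hx]
  have hpc : ∀ k x, p^[k] (c^[k] x) = x := fun k x =>
    (Function.LeftInverse.iterate (g := p) (f := c) hc k) x
  have hD : ∀ z, p z = v0 → ∀ k, p^[k + 1] (c^[k] z) = v0 := by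
    intro z hz k
    rw [Function.iterate_succ_apply', hpc, hz]
  -- elements of strict chains avoid `v0`, `a`, `b`
  have hne1 : ∀ z, p z = v0 → ∀ y, p y = v0 → ∀ k, c^[k + 1] z ≠ y := by
    intro z hz y hy k h
    have h1 := hD z hz (k + 1)
    rw [h, Function.iterate_succ_apply, hy] at h1
    exact per _ h1
  have hne0 : ∀ z, p z = v0 → ∀ k, c^[k] z ≠ v0 := fun z hz k => (hDv _ _ (hD z hz k)).1
  have hdis0 : ∀ y z, p y = v0 → p z = v0 → y ≠ z → ∀ k j, k ≤ j → c^[k] y ≠ c^[j] z := by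
    intro y z hy hz hyz k j hkj h
    obtain ⟨d, rfl⟩ := Nat.exists_eq_add_of_le hkj
    rw [Function.iterate_add_apply] at h
    have h2 : y = c^[d] z := by
      have := congrArg (p^[k]) h
      rwa [hpc, hpc] at this
    cases d with
    | zero => exact hyz (by simpa using h2)
    | succ d => exact hne1 z hz y hy d h2.symm
  have hdis : ∀ k j, c^[k] a ≠ c^[j] b := by
    intro k j
    rcases le_total k j with h | h
    · exact hdis0 a b ha hb hab k j h
    · exact (hdis0 b a hb ha hab.symm j k h).symm
  have hpd : ∀ z k, p (c^[k + 1] z) = c^[k] z := by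
    intro z k; rw [Function.iterate_succ_apply', hc]
  let A : V → Prop := fun v => ∃ k, v = c^[k + 1] a
  let B : V → Prop := fun v => ∃ k, v = c^[k + 1] b
  let lam : V → ℂ := fun v => if v = v0 then 8 / 5 else if v = a then 3 / 5 else
    if v = b then 8 / 5 else if A v then 1 else if B v then 2 else 0
  have ha0 : a ≠ v0 := hne0 a ha 0
  have hb0 : b ≠ v0 := hne0 b hb 0
  refine ⟨lam, A, B, ?_, ?_, ?_, ?_, ?_, ?_, ⟨0, rfl⟩, ⟨0, rfl⟩, ?_, ?_, ?_, ?_,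
    ha0, (hDv 0 a ha).2, hb0, (hDv 0 b hb).2, ?_, ?_⟩
  · simp [lam]
  · simp [lam, ha0]
  · simp [lam, hb0, hab.symm]
  · intro v hv
    have hv' := hv
    obtain ⟨k, rfl⟩ := hv
    simp only [lam]
    rw [if_neg (hne0 a ha _), if_neg (hne1 a ha a ha k), if_neg (hne1 a ha b hb k), if_pos hv']
  · intro v hv
    have hv' := hv
    obtain ⟨k, rfl⟩ := hv
    simp only [lam]
    rw [if_neg (hne0 b hb _), if_neg (hne1 b hb a ha k), if_neg (hne1 b hb b hb k), if_neg,
      if_pos hv']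
    rintro ⟨j, hj⟩
    exact hdis _ _ hj.symm
  · intro v hv
    by_contra hcon
    push Not at hcon
    obtain ⟨h1, h2, h3, h4, h5⟩ := hcon
    apply hv
    simp only [lam]
    rw [if_neg h1, if_neg h2, if_neg h3, if_neg h4, if_neg h5]
  · rintro v ⟨k, rfl⟩
    exact ⟨k + 1, (Function.iterate_succ_apply' c (k + 1) a).symm⟩
  · rintro v ⟨k, rfl⟩
    exact ⟨k + 1, (Function.iterate_succ_apply' c (k + 1) b).symm⟩
  · rintro v (⟨k, rfl⟩ | ⟨k, rfl⟩)
    · rw [hpd, Function.iterate_succ_apply']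
    · rw [hpd, Function.iterate_succ_apply']
  · rintro v (⟨k, rfl⟩ | ⟨k, rfl⟩)
    · rw [hpd]; exact hDv _ _ (hD a ha k)
    · rw [hpd]; exact hDv _ _ (hD b hb k)
  · have hfix : ∀ z, p z = v0 → ∀ k, p (c^[k] z) ≠ c^[k] z := by
      intro z hz k
      apply nonroot_iter hc
      intro h
      exact hne0 z hz 0 (h.symm.trans hz)
    rintro v (⟨k, rfl⟩ | ⟨k, rfl⟩)
    · exact hfix a ha _
    · exact hfix b hb _
  · rintro v (⟨k, rfl⟩ | ⟨k, rfl⟩)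
    · exact hDv _ _ (hD a ha _)
    · exact hDv _ _ (hD b hb _)

lemma counterexample {V : Type*} (p : V → V) (hp : IsDirectedForest p)
    (hsurj : Function.Surjective p) (hf : ¬ Forkless p) :
    ∃ S : L2 V →L[ℂ] L2 V, IsWeightedShift p S ∧ Hyponormal S ∧ ¬ Hyponormal (S ^ 2) := by
  classical
  obtain ⟨c, hc⟩ : ∃ c : V → V, ∀ v, p (c v) = v :=
    ⟨Function.surjInv hsurj, Function.surjInv_eq hsurj⟩
  obtain ⟨v0, a, b, hv0, ha, hb, hab⟩ :
      ∃ v0 a b, p v0 ≠ v0 ∧ p a = v0 ∧ p b = v0 ∧ a ≠ b := by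
    by_contra hcon
    push Not at hcon
    apply hf
    intro v hv
    refine ⟨c v, ⟨hc v, fun h => hv ?_⟩, ?_⟩
    · have := hc v
      rwa [h] at this
    · rintro y ⟨hy, -⟩
      exact hcon v y (c v) hv hy (hc v)
  obtain ⟨lam, A, B, l0, la, lb, lA, lB, lsup, Aca, Bcb, Ac, Bc, hAB, hABp, a0, aw, b0, bw, hABf, hAB0⟩ :=
    exists_weights p hp c hc v0 a b hv0 ha hb hab
  have sup_w : ∀ x, p x = p v0 → lam x ≠ 0 → x = v0 := by
    intro x hx hl
    rcases lsup x hl with h | h | h | h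
    · exact h
    · subst h; exact absurd (hx.symm.trans ha) hv0
    · subst h; exact absurd (hx.symm.trans hb) hv0
    · exact absurd hx (hABp x h).2
  have sup_v0 : ∀ x, p x = v0 → lam x ≠ 0 → x = a ∨ x = b := by
    intro x hx hl
    rcases lsup x hl with h | h | h | h
    · subst h; exact absurd hx hv0
    · exact Or.inl h
    · exact Or.inr h
    · exact absurd hx (hABp x h).1
  have sup_else : ∀ u, u ≠ v0 → u ≠ p v0 → ∀ x, p x = u → lam x ≠ 0 → x = c u := by
    intro u h0 hw x hx hl
    subst hx
    rcases lsup x hl with h | h | h | h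
    · subst h; exact absurd rfl hw
    · subst h; exact absurd ha h0
    · subst h; exact absurd hb h0
    · exact hAB x h
  have hroot : ∀ ω : V, p ω = ω → lam ω = 0 := by
    intro ω hω
    by_contra hl
    rcases lsup ω hl with h | h | h | h
    · subst h; exact hv0 hω
    · subst h; exact a0 (hω.symm.trans ha)
    · subst h; exact b0 (hω.symm.trans hb)
    · exact hABf ω h hω
  have hbd : ∀ v, ‖lam v‖ ^ 2 ≤ 4 := by
    intro v
    by_cases hl : lam v = 0
    · rw [hl]; norm_num
    · rcases lsup v hl with h | h | h | h | h
      · rw [h, l0]; norm_num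
      · rw [h, la]; norm_num
      · rw [h, lb]; norm_num
      · rw [lA v h]; norm_num
      · rw [lB v h]; norm_num
  obtain ⟨S, hS⟩ := WC.exists 4 (by norm_num) p lam (by
    intro v F hF
    refine (sum_le_of_support (fun u => ‖lam u‖ ^ 2) (fun _ => by positivity) F
      ({v0, a, b, c v} : Finset V) ?_).trans ?_
    · intro u hu hne
      have hl : lam u ≠ 0 := fun h => hne (by simp [h])
      rcases lsup u hl with h | h | h | h
      · simp [h]
      · simp [h]
      · simp [h]
      · have := hAB u h
        rw [hF u hu] at this
        simp [← this]
    · refine (Finset.sum_le_card_nsmul _ _ 4 (fun x _ => hbd x)).trans ?_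
      have : ({v0, a, b, c v} : Finset V).card ≤ 4 := Finset.card_le_four
      have : (({v0, a, b, c v} : Finset V).card : ℝ) ≤ 4 := by exact_mod_cast this
      rw [nsmul_eq_mul]; linarith)
  have SE : ∀ u, u ≠ v0 → u ≠ p v0 → S (E u) = lam (c u) • E (c u) := fun u h0 hw =>
    hS.apply_E_single (hc u) (sup_else u h0 hw)
  have nSE : ∀ u, u ≠ v0 → u ≠ p v0 → ‖S (E u)‖ = ‖lam (c u)‖ := fun u h0 hw => by
    rw [SE u h0 hw, norm_smul, E_norm, mul_one]
  have ta : ‖S (E a)‖ = 1 := by rw [nSE a a0 aw, lA _ Aca]; norm_num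
  have tb : ‖S (E b)‖ = 2 := by rw [nSE b b0 bw, lB _ Bcb]; norm_num
  have tA : ∀ v, A v → ‖S (E v)‖ = 1 := fun v hv => by
    rw [nSE v (hAB0 v (Or.inl hv)).1 (hAB0 v (Or.inl hv)).2, lA _ (Ac v hv)]; norm_num
  have tB : ∀ v, B v → ‖S (E v)‖ = 2 := fun v hv => by
    rw [nSE v (hAB0 v (Or.inr hv)).1 (hAB0 v (Or.inr hv)).2, lB _ (Bc v hv)]; norm_num
  have t0 : 73 / 25 ≤ ‖S (E v0)‖ ^ 2 := by
    refine le_trans (le_of_eq ?_) (hS.le_norm v0 {a, b} (by simp [ha, hb]))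
    rw [Finset.sum_pair hab, la, lb]; norm_num
  refine ⟨S, ⟨lam, hroot, hS⟩, ?_, ?_⟩
  · apply hS.hyp_of_crit
    constructor
    · intro u hu
      by_contra hl
      have hn : ‖S (E u)‖ = 0 := by rw [hu, norm_zero]
      rcases lsup u hl with h | h | h | h | h
      · rw [h] at hn; rw [hn] at t0; norm_num at t0
      · rw [h, ta] at hn; norm_num at hn
      · rw [h, tb] at hn; norm_num at hn
      · rw [tA u h] at hn; norm_num at hn
      · rw [tB u h] at hn; norm_num at hn
    · intro v F hF
      have hnz : ∀ u, ‖lam u‖ ^ 2 / ‖S (E u)‖ ^ 2 ≠ 0 → lam u ≠ 0 :=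
        fun u hne h => hne (by simp [h])
      by_cases hvw : v = p v0
      · refine (sum_le_of_support (fun u => ‖lam u‖ ^ 2 / ‖S (E u)‖ ^ 2)
          (fun _ => by positivity) F {v0} ?_).trans ?_
        · intro u hu hne
          rw [Finset.mem_singleton]
          exact sup_w u ((hF u hu).trans hvw) (hnz u hne)
        · rw [Finset.sum_singleton, l0, div_le_one (by linarith)]
          refine le_trans ?_ t0
          norm_num
      by_cases hv1 : v = v0
      · refine (sum_le_of_support (fun u => ‖lam u‖ ^ 2 / ‖S (E u)‖ ^ 2)
          (fun _ => by positivity) F {a, b} ?_).trans ?_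
        · intro u hu hne
          have := sup_v0 u ((hF u hu).trans hv1) (hnz u hne)
          simpa using this
        · rw [Finset.sum_pair hab, la, lb, ta, tb]; norm_num
      · refine (sum_le_of_support (fun u => ‖lam u‖ ^ 2 / ‖S (E u)‖ ^ 2)
          (fun _ => by positivity) F {c v} ?_).trans ?_
        · intro u hu hne
          rw [Finset.mem_singleton]
          exact sup_else v hv1 hvw u (hF u hu) (hnz u hne)
        · rw [Finset.sum_singleton]
          by_cases hl : lam (c v) = 0
          · rw [hl]; norm_num
          · rcases lsup _ hl with h | h | h | h | h
            · exact absurd (by rw [← h, hc]) hvw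
            · exact absurd (by rw [← ha, ← h, hc]) hv1
            · exact absurd (by rw [← hb, ← h, hc]) hv1
            · rw [lA _ h, tA _ h]; norm_num
            · rw [lB _ h, tB _ h]; norm_num
  · intro hcon
    have h2 := ((hS.pow 2).crit_of_hyp hcon).2 (p v0) {a, b} (by simp [ha, hb])
    have ea : ‖(S ^ 2) (E a)‖ = 1 := by
      rw [pow_two, ContinuousLinearMap.mul_apply, SE a a0 aw, map_smul, norm_smul, tA _ Aca,
        lA _ Aca]
      norm_num
    have eb : ‖(S ^ 2) (E b)‖ = 4 := by
      rw [pow_two, ContinuousLinearMap.mul_apply, SE b b0 bw, map_smul, norm_smul, tB _ Bcb,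
        lB _ Bcb]
      norm_num
    rw [Finset.sum_pair hab, ea, eb] at h2
    simp only [Lam, ha, hb, l0, la, lb] at h2
    norm_num at h2

theorem stmt_18 {V : Type*} [Nonempty V] (p : V → V)
    (hp : IsDirectedForest p) (hleafless : Function.Surjective p)
    (hloc : ∀ v : V, (treeOf p v).Countable) :
    ((∀ S : L2 V →L[ℂ] L2 V, IsWeightedShift p S → Hyponormal S →
        ∀ n : ℕ, 1 ≤ n → Hyponormal (S ^ n)) ↔ Forkless p) ∧
    ((∀ S : L2 V →L[ℂ] L2 V, IsWeightedShift p S → Hyponormal S →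
        Hyponormal (S ^ 2)) ↔ Forkless p) := by
  have back : Forkless p → ∀ S : L2 V →L[ℂ] L2 V, IsWeightedShift p S → Hyponormal S →
      ∀ n : ℕ, 1 ≤ n → Hyponormal (S ^ n) := by
    rintro hf S ⟨lam, hroot, hS⟩ hh n hn
    exact forkless_pow hleafless hf hroot hS hh n hn
  have forth : (∀ S : L2 V →L[ℂ] L2 V, IsWeightedShift p S → Hyponormal S →
      Hyponormal (S ^ 2)) → Forkless p := by
    intro h
    by_contra hf
    obtain ⟨S, h1, h2, h3⟩ := counterexample p hp hleafless hf
    exact h3 (h S h1 h2)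
  exact ⟨⟨fun h => forth fun S h1 h2 => h S h1 h2 2 (by norm_num), back⟩,
    ⟨forth, fun hf S h1 h2 => back hf S h1 h2 2 (by norm_num)⟩⟩
end
end
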